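/- The following are equivalent: (a) for every R > 1 and every function F analytic on the open ball of radius R centered at 0 with F(z) ≠ 0 for all |z| < 1, the sequence of Taylor coefficients of F at 0 is cyclic in H_w; (b) there exist R > 1 and a function F analytic on the open ball of radius R centered at 0, with F(z) ≠ 0 for all |z| < 1 and F(e^{iθ}) = 0 for some θ ∈ ℝ, whose sequence of Taylor coefficients at 0 is cyclic in H_w; (c) ∑_{k=0}^∞ 1/w_k = ∞. -/

import Mathlib

open scoped BigOperators ComplexConjugate
open Filter

def MemHw (w : ℕ → ℝ) (f : ℕ → ℂ) : Prop :=
  Summable fun n => w n * ‖f n‖ ^ 2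

noncomputable def normSqHw (w : ℕ → ℝ) (f : ℕ → ℂ) : ℝ :=
  ∑' n, w n * ‖f n‖ ^ 2

noncomputable def normHw (w : ℕ → ℝ) (f : ℕ → ℂ) : ℝ :=
  Real.sqrt (normSqHw w f)

noncomputable def innerHw (w : ℕ → ℝ) (f g : ℕ → ℂ) : ℂ :=
  ∑' n, (w n : ℂ) * f n * conj (g n)

noncomputable def cProd (f g : ℕ → ℂ) : ℕ → ℂ :=
  fun n => ∑ k ∈ Finset.range (n + 1), f k * g (n - k)

def onePS : ℕ → ℂ := fun n => if n = 0 then 1 else 0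

def IsPolySeq (p : ℕ → ℂ) : Prop := ∃ N, ∀ n, N < n → p n = 0

def DegLE (p : ℕ → ℂ) (n : ℕ) : Prop := ∀ m, n < m → p m = 0

def CyclicHw (w : ℕ → ℝ) (f : ℕ → ℂ) : Prop :=
  ∀ ε : ℝ, 0 < ε → ∃ p : ℕ → ℂ, IsPolySeq p ∧ normHw w (cProd p f - onePS) < ε

noncomputable def taylorCoeff (F : ℂ → ℂ) (n : ℕ) : ℂ :=
  iteratedDeriv n F 0 / (n.factorial : ℂ)

noncomputable def phiW (w : ℕ → ℝ) (k : ℕ) : ℝ :=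
  ∑ j ∈ Finset.range (k + 1), 1 / w j

def oneSubZ : ℕ → ℂ := fun k => if k = 0 then 1 else if k = 1 then -1 else 0

def zPow (i : ℕ) (f : ℕ → ℂ) : ℕ → ℂ :=
  fun m => if i ≤ m then f (m - i) else 0

lemma cProd_eq_coeff (f g : ℕ → ℂ) (n : ℕ) :
    cProd f g n = PowerSeries.coeff n (PowerSeries.mk f * PowerSeries.mk g) := by
  rw [PowerSeries.coeff_mul, Finset.Nat.sum_antidiagonal_eq_sum_range_succ_mk]
  simp [cProd]

lemma mk_cProd (f g : ℕ → ℂ) :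
    PowerSeries.mk (cProd f g) = PowerSeries.mk f * PowerSeries.mk g := by
  ext n
  rw [PowerSeries.coeff_mk, cProd_eq_coeff]

lemma mk_onePS : PowerSeries.mk onePS = 1 := by
  ext n
  simp [onePS, PowerSeries.coeff_one]

lemma mk_sub (f g : ℕ → ℂ) :
    PowerSeries.mk (f - g) = PowerSeries.mk f - PowerSeries.mk g := by
  ext n
  simp

lemma mk_add (f g : ℕ → ℂ) :
    PowerSeries.mk (f + g) = PowerSeries.mk f + PowerSeries.mk g := by
  ext n
  simp

lemma mk_injective : Function.Injective (PowerSeries.mk : (ℕ → ℂ) → PowerSeries ℂ) := by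
  intro f g h
  funext n
  simpa using congrArg (PowerSeries.coeff n) h

lemma cProd_onePS (f : ℕ → ℂ) : cProd f onePS = f :=
  mk_injective (by rw [mk_cProd, mk_onePS, mul_one])

lemma IsPolySeq.cProd {p q : ℕ → ℂ} (hp : IsPolySeq p) (hq : IsPolySeq q) :
    IsPolySeq (cProd p q) := by
  obtain ⟨N, hN⟩ := hp
  obtain ⟨M, hM⟩ := hq
  refine ⟨N + M, fun n hn => Finset.sum_eq_zero fun k _ => ?_⟩
  by_cases hk : N < k
  · rw [hN k hk, zero_mul]
  · rw [hM (n - k) (by omega), mul_zero]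

/-- Geometrically decaying sequences: Taylor coefficients of functions analytic on a
neighbourhood of the closed unit disc. -/
def GeomDecay (a : ℕ → ℂ) : Prop := ∃ ρ : ℝ, 1 < ρ ∧ Summable fun k => ‖a k‖ * ρ ^ k

lemma IsPolySeq.geomDecay {p : ℕ → ℂ} (hp : IsPolySeq p) : GeomDecay p := by
  obtain ⟨N, hN⟩ := hp
  refine ⟨2, one_lt_two, summable_of_ne_finset_zero (s := Finset.range (N + 1)) fun n hn => ?_⟩
  rw [hN n (by simpa using hn)]
  simp

lemma GeomDecay.summable_norm {a : ℕ → ℂ} (ha : GeomDecay a) : Summable fun k => ‖a k‖ := by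
  obtain ⟨ρ, hρ, h⟩ := ha
  exact h.of_nonneg_of_le (fun _ => norm_nonneg _)
    fun k => le_mul_of_one_le_right (norm_nonneg _) (one_le_pow₀ hρ.le)

lemma exists_le_mul_of_eventually_antitone (N : ℕ) : ∀ v : ℕ → ℝ, (∀ n, 0 < v n) →
    (∀ n, N ≤ n → v (n + 1) ≤ v n) → ∃ C : ℝ, 1 ≤ C ∧ ∀ m k, v (m + k) ≤ C * v m := by
  induction N with
  | zero =>
    intro v _ h
    refine ⟨1, le_rfl, fun m k => ?_⟩
    rw [one_mul]
    exact antitone_nat_of_succ_le (fun n => h n n.zero_le) (Nat.le_add_right m k)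
  | succ N ih =>
    intro v hv h
    obtain ⟨C, hC, hb⟩ := ih (fun n => v (n + 1)) (fun n => hv _) fun n hn => h (n + 1) (by omega)
    have hq : 0 < v 1 / v 0 := div_pos (hv 1) (hv 0)
    refine ⟨C * (1 + v 1 / v 0), by nlinarith, fun m k => ?_⟩
    rcases m with _ | m
    · rcases k with _ | k
      · have := hv 0
        have h1 : 1 ≤ C * (1 + v 1 / v 0) := by nlinarith
        simpa using le_mul_of_one_le_left this.le h1
      · have h1 := hb 0 k
        have h2 : C * (1 + v 1 / v 0) * v 0 = C * v 0 + C * v 1 := by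
          have := (hv 0).ne'
          field_simp
        rw [h2]
        have h3 : 0 < C * v 0 := mul_pos (by linarith) (hv 0)
        simp only [zero_add] at h1 ⊢
        linarith
    · have h1 := hb m k
      have h3 : 0 ≤ C * (v 1 / v 0) * v (m + 1) :=
        mul_nonneg (mul_nonneg (by linarith) hq.le) (hv _).le
      have h4 : m + 1 + k = m + k + 1 := by omega
      rw [h4]
      nlinarith

lemma exists_weight_growth_bound {w : ℕ → ℝ} (hw : ∀ n, 0 < w n)
    (hw1 : Tendsto (fun n => w (n + 1) / w n) atTop (nhds 1)) {ρ : ℝ} (hρ : 1 < ρ) :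
    ∃ C : ℝ, 1 ≤ C ∧ ∀ m k, w (m + k) ≤ C * ρ ^ k * w m := by
  obtain ⟨N, hN⟩ := eventually_atTop.1 (hw1.eventually_le_const hρ)
  have hρ0 : 0 < ρ := by linarith
  obtain ⟨C, hC, h⟩ := exists_le_mul_of_eventually_antitone N (fun n => w n / ρ ^ n)
    (fun n => div_pos (hw n) (pow_pos hρ0 n)) fun n hn => by
      have h1 := (div_le_iff₀ (hw n)).1 (hN n hn)
      rw [div_le_div_iff₀ (pow_pos hρ0 _) (pow_pos hρ0 _), pow_succ]
      nlinarith [pow_pos hρ0 n]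
  refine ⟨C, hC, fun m k => ?_⟩
  have h1 := h m k
  rw [div_le_iff₀ (pow_pos hρ0 _), pow_add] at h1
  have h2 : C * (w m / ρ ^ m) * (ρ ^ m * ρ ^ k) = C * ρ ^ k * w m := by
    have := (pow_pos hρ0 m).ne'
    field_simp
  rwa [h2] at h1

lemma norm_cProd_sq_le (a h : ℕ → ℂ) (n : ℕ) :
    ‖cProd a h n‖ ^ 2 ≤ (∑ k ∈ Finset.range (n + 1), ‖a k‖) *
      ∑ k ∈ Finset.range (n + 1), ‖a k‖ * ‖h (n - k)‖ ^ 2 := by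
  have h1 : ‖cProd a h n‖ ≤ ∑ k ∈ Finset.range (n + 1), ‖a k‖ * ‖h (n - k)‖ :=
    (norm_sum_le _ _).trans_eq (Finset.sum_congr rfl fun k _ => norm_mul _ _)
  refine (pow_le_pow_left₀ (norm_nonneg _) h1 2).trans ?_
  exact Finset.sum_sq_le_sum_mul_sum_of_sq_le_mul _ (fun _ _ => norm_nonneg _)
    (fun _ _ => by positivity) fun _ _ => le_of_eq (by ring)

/-- Geometrically decaying sequences are bounded multipliers. -/
lemma GeomDecay.exists_multiplier_bound {w : ℕ → ℝ} (hw : ∀ n, 0 < w n)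
    (hw1 : Tendsto (fun n => w (n + 1) / w n) atTop (nhds 1)) {a : ℕ → ℂ} (ha : GeomDecay a) :
    ∃ M : ℝ, 0 < M ∧ ∀ h, MemHw w h →
      MemHw w (cProd a h) ∧ normSqHw w (cProd a h) ≤ M * normSqHw w h := by
  have hs := ha.summable_norm
  obtain ⟨ρ, hρ, hsρ⟩ := ha
  obtain ⟨C, hC, hgrow⟩ := exists_weight_growth_bound hw hw1 hρ
  have hρ0 : 0 < ρ := by linarith
  set A := ∑' k, ‖a k‖ with hA
  set B := ∑' k, ‖a k‖ * ρ ^ k with hB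
  have hA0 : 0 ≤ A := tsum_nonneg fun _ => norm_nonneg _
  have hB0 : 0 ≤ B := tsum_nonneg fun _ => by positivity
  refine ⟨A * C * B + 1, by positivity, fun h hh => ?_⟩
  have hpos : ∀ n, 0 ≤ w n * ‖h n‖ ^ 2 := fun n => mul_nonneg (hw n).le (by positivity)
  have hterm : ∀ n, w n * ‖cProd a h n‖ ^ 2 ≤ A * C *
      ∑ k ∈ Finset.range (n + 1), (‖a k‖ * ρ ^ k) * (w (n - k) * ‖h (n - k)‖ ^ 2) := by
    intro n
    calc w n * ‖cProd a h n‖ ^ 2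
        ≤ w n * (A * ∑ k ∈ Finset.range (n + 1), ‖a k‖ * ‖h (n - k)‖ ^ 2) := by
          refine mul_le_mul_of_nonneg_left ((norm_cProd_sq_le a h n).trans ?_) (hw n).le
          exact mul_le_mul_of_nonneg_right (hs.sum_le_tsum _ fun _ _ => norm_nonneg _)
            (Finset.sum_nonneg fun _ _ => by positivity)
      _ = A * ∑ k ∈ Finset.range (n + 1), w n * (‖a k‖ * ‖h (n - k)‖ ^ 2) := by
          rw [← Finset.mul_sum]
          ring
      _ ≤ A * ∑ k ∈ Finset.range (n + 1),
            C * ((‖a k‖ * ρ ^ k) * (w (n - k) * ‖h (n - k)‖ ^ 2)) := by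
          refine mul_le_mul_of_nonneg_left (Finset.sum_le_sum fun k hk => ?_) hA0
          have h1 := hgrow (n - k) k
          rw [Nat.sub_add_cancel (Nat.lt_succ_iff.1 (Finset.mem_range.1 hk))] at h1
          calc w n * (‖a k‖ * ‖h (n - k)‖ ^ 2)
              ≤ C * ρ ^ k * w (n - k) * (‖a k‖ * ‖h (n - k)‖ ^ 2) :=
                mul_le_mul_of_nonneg_right h1 (by positivity)
            _ = _ := by ring
      _ = _ := by rw [← Finset.mul_sum, mul_assoc]
  have hn1 : Summable fun k => ‖‖a k‖ * ρ ^ k‖ := hsρ.norm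
  have hn2 : Summable fun n => ‖w n * ‖h n‖ ^ 2‖ := Summable.norm hh
  have hconv : Summable fun n => ∑ k ∈ Finset.range (n + 1),
      (‖a k‖ * ρ ^ k) * (w (n - k) * ‖h (n - k)‖ ^ 2) :=
    (summable_norm_sum_mul_range_of_summable_norm hn1 hn2).of_norm
  have hmem : MemHw w (cProd a h) := Summable.of_nonneg_of_le
    (fun n => mul_nonneg (hw n).le (by positivity)) hterm (hconv.mul_left _)
  refine ⟨hmem, ?_⟩
  have h1 : normSqHw w (cProd a h) ≤ A * C * (B * normSqHw w h) := by
    rw [hB, normSqHw, normSqHw, tsum_mul_tsum_eq_tsum_sum_range_of_summable_norm hn1 hn2,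
      ← tsum_mul_left]
    exact hmem.tsum_le_tsum hterm (hconv.mul_left _)
  have h2 : 0 ≤ normSqHw w h := tsum_nonneg hpos
  nlinarith

lemma memHw_onePS (w : ℕ → ℝ) : MemHw w onePS :=
  summable_of_ne_finset_zero (s := {0}) fun n hn => by
    simp [onePS, show n ≠ 0 by simpa using hn]

lemma GeomDecay.memHw {w : ℕ → ℝ} (hw : ∀ n, 0 < w n)
    (hw1 : Tendsto (fun n => w (n + 1) / w n) atTop (nhds 1)) {a : ℕ → ℂ} (ha : GeomDecay a) :
    MemHw w a := by
  obtain ⟨M, -, h⟩ := ha.exists_multiplier_bound hw hw1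
  simpa only [cProd_onePS] using (h _ (memHw_onePS w)).1

lemma MemHw.add_and_normSqHw_add_le {w : ℕ → ℝ} (hw : ∀ n, 0 < w n) {f g : ℕ → ℂ}
    (hf : MemHw w f) (hg : MemHw w g) :
    MemHw w (f + g) ∧ normSqHw w (f + g) ≤ 2 * normSqHw w f + 2 * normSqHw w g := by
  have hterm : ∀ n, w n * ‖(f + g) n‖ ^ 2 ≤ 2 * (w n * ‖f n‖ ^ 2) + 2 * (w n * ‖g n‖ ^ 2) := by
    intro n
    have h1 : ‖(f + g) n‖ ^ 2 ≤ (‖f n‖ + ‖g n‖) ^ 2 :=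
      pow_le_pow_left₀ (norm_nonneg _) (norm_add_le _ _) 2
    have h2 : ‖(f + g) n‖ ^ 2 ≤ 2 * ‖f n‖ ^ 2 + 2 * ‖g n‖ ^ 2 := by
      nlinarith [sq_nonneg (‖f n‖ - ‖g n‖)]
    nlinarith [mul_le_mul_of_nonneg_left h2 (hw n).le]
  have hsum := (hf.mul_left 2).add (hg.mul_left 2)
  have hmem : MemHw w (f + g) := Summable.of_nonneg_of_le
    (fun n => mul_nonneg (hw n).le (by positivity)) hterm hsum
  refine ⟨hmem, (hmem.tsum_le_tsum hterm hsum).trans_eq ?_⟩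
  rw [(hf.mul_left 2).tsum_add (hg.mul_left 2), tsum_mul_left, tsum_mul_left]
  rfl

lemma MemHw.sub {w : ℕ → ℝ} (hw : ∀ n, 0 < w n) {f g : ℕ → ℂ}
    (hf : MemHw w f) (hg : MemHw w g) : MemHw w (f - g) := by
  rw [sub_eq_add_neg]
  refine (MemHw.add_and_normSqHw_add_le hw hf ?_).1
  simpa [MemHw] using hg

lemma cyclicHw_iff_normSqHw {w : ℕ → ℝ} (f : ℕ → ℂ) :
    CyclicHw w f ↔ ∀ ε : ℝ, 0 < ε → ∃ p : ℕ → ℂ, IsPolySeq p ∧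
      normSqHw w (cProd p f - onePS) < ε := by
  constructor
  · intro h ε hε
    obtain ⟨p, hp, hlt⟩ := h (√ε) (Real.sqrt_pos.2 hε)
    exact ⟨p, hp, lt_of_not_ge fun hge => (Real.sqrt_le_sqrt hge).not_gt hlt⟩
  · intro h ε hε
    obtain ⟨p, hp, hlt⟩ := h (ε ^ 2) (by positivity)
    exact ⟨p, hp, (Real.sqrt_lt' hε).2 hlt⟩

lemma CyclicHw.cProd {w : ℕ → ℝ} (hw : ∀ n, 0 < w n)
    (hw1 : Tendsto (fun n => w (n + 1) / w n) atTop (nhds 1)) {f g : ℕ → ℂ}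
    (hfd : GeomDecay f) (hgd : GeomDecay g) (hf : CyclicHw w f) (hg : CyclicHw w g) :
    CyclicHw w (cProd f g) := by
  rw [cyclicHw_iff_normSqHw] at *
  intro ε hε
  obtain ⟨q, hq, hqε⟩ := hg (ε / 4) (by positivity)
  obtain ⟨Mq, hMq, hq_bd⟩ := hq.geomDecay.exists_multiplier_bound hw hw1
  obtain ⟨Mg, hMg, hg_bd⟩ := hgd.exists_multiplier_bound hw hw1
  obtain ⟨p, hp, hpε⟩ := hf (ε / (4 * Mq * Mg)) (by positivity)
  obtain ⟨Mp, hMp, hp_bd⟩ := hp.geomDecay.exists_multiplier_bound hw hw1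
  refine ⟨_root_.cProd q p, hq.cProd hp, ?_⟩
  have key : _root_.cProd (_root_.cProd q p) (_root_.cProd f g) - onePS =
      _root_.cProd q (_root_.cProd g (_root_.cProd p f - onePS)) +
        (_root_.cProd q g - onePS) := by
    apply mk_injective
    simp only [mk_sub, mk_add, mk_cProd, mk_onePS]
    ring
  have hm1 : MemHw w (_root_.cProd p f - onePS) :=
    (hp_bd _ (hfd.memHw hw hw1)).1.sub hw (memHw_onePS w)
  have hm2 := hg_bd _ hm1
  have hm3 := hq_bd _ hm2.1
  have hm4 : MemHw w (_root_.cProd q g - onePS) :=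
    (hq_bd _ (hgd.memHw hw hw1)).1.sub hw (memHw_onePS w)
  rw [key]
  have hfin := (hm3.1.add_and_normSqHw_add_le hw hm4).2
  rw [lt_div_iff₀ (by positivity)] at hpε
  have h5 := mul_le_mul_of_nonneg_left hm2.2 hMq.le
  nlinarith [hm3.2]

lemma cyclicHw_of_cProd_eq_onePS {w : ℕ → ℝ} (hw : ∀ n, 0 < w n)
    (hw1 : Tendsto (fun n => w (n + 1) / w n) atTop (nhds 1)) {b g : ℕ → ℂ}
    (hbd : GeomDecay b) (hgd : GeomDecay g) (hbg : cProd b g = onePS) : CyclicHw w g := by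
  rw [cyclicHw_iff_normSqHw]
  intro ε hε
  obtain ⟨M, hM, hbound⟩ := hgd.exists_multiplier_bound hw hw1
  have hb : MemHw w b := hbd.memHw hw hw1
  have ht := tendsto_sum_nat_add fun n => w n * ‖b n‖ ^ 2
  obtain ⟨N, hN⟩ := (ht.eventually_lt_const (div_pos hε hM)).exists
  set p : ℕ → ℂ := fun n => if n < N then b n else 0 with hp
  have hpoly : IsPolySeq p := ⟨N, fun n hn => if_neg (by omega)⟩
  refine ⟨p, hpoly, ?_⟩
  have key : cProd p g - onePS = cProd g (p - b) := by
    rw [← hbg]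
    apply mk_injective
    simp only [mk_sub, mk_cProd]
    ring
  have hmem : MemHw w (p - b) := (hpoly.geomDecay.memHw hw hw1).sub hw hb
  have htail : normSqHw w (p - b) = ∑' k, w (k + N) * ‖b (k + N)‖ ^ 2 := by
    rw [normSqHw, ← hmem.sum_add_tsum_nat_add N, Finset.sum_eq_zero, zero_add]
    · simp [hp]
    · intro i hi
      simp [hp, Finset.mem_range.1 hi]
  rw [key]
  refine (hbound _ hmem).2.trans_lt ?_
  rw [htail, mul_comm]
  exact (lt_div_iff₀ hM).1 hN

lemma hasSum_taylorCoeff {F : ℂ → ℂ} {R : ℝ}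
    (hF : ∀ z ∈ Metric.ball (0 : ℂ) R, AnalyticAt ℂ F z) {z : ℂ} (hz : ‖z‖ < R) :
    HasSum (fun n => taylorCoeff F n * z ^ n) (F z) := by
  have h := Complex.hasSum_taylorSeries_on_ball (f := F) (c := 0) (r := R) (z := z)
    (fun y hy => (hF y hy).differentiableAt.differentiableWithinAt) (by simpa using hz)
  refine h.congr_fun fun n => ?_
  simp only [taylorCoeff, sub_zero, smul_eq_mul]
  ring

lemma geomDecay_taylorCoeff {F : ℂ → ℂ} {R : ℝ} (hR : 1 < R)
    (hF : ∀ z ∈ Metric.ball (0 : ℂ) R, AnalyticAt ℂ F z) : GeomDecay (taylorCoeff F) := by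
  obtain ⟨ρ, h1, h2⟩ := exists_between hR
  refine ⟨ρ, h1, ?_⟩
  have hnorm : ‖(ρ : ℂ)‖ = ρ := by simp [abs_of_pos (zero_lt_one.trans h1)]
  have h := (hasSum_taylorCoeff hF (z := ρ) (by rwa [hnorm])).summable.norm
  simpa only [norm_mul, norm_pow, hnorm] using h

lemma taylorCoeff_mul {F G : ℂ → ℂ} (hF : AnalyticAt ℂ F 0) (hG : AnalyticAt ℂ G 0) :
    taylorCoeff (F * G) = cProd (taylorCoeff F) (taylorCoeff G) := by
  funext n
  rw [taylorCoeff, iteratedDeriv_mul hF.contDiffAt hG.contDiffAt, cProd, Finset.sum_div]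
  refine Finset.sum_congr rfl fun k hk => ?_
  have hk' : k ≤ n := Nat.lt_succ_iff.1 (Finset.mem_range.1 hk)
  rw [Nat.cast_choose ℂ hk', taylorCoeff, taylorCoeff]
  have := Nat.factorial_ne_zero n
  field_simp

lemma taylorCoeff_congr {F G : ℂ → ℂ} (h : F =ᶠ[nhds 0] G) : taylorCoeff F = taylorCoeff G := by
  funext n
  rw [taylorCoeff, taylorCoeff, h.iteratedDeriv_eq]

lemma taylorCoeff_one : taylorCoeff 1 = onePS := by
  funext n
  have h : (1 : ℂ → ℂ) = fun _ => 1 := rfl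
  rcases n with _ | n <;> simp [taylorCoeff, onePS, h, iteratedDeriv_const]

lemma mk_taylorCoeff_sub_const (u : ℂ) :
    PowerSeries.mk (taylorCoeff (· - u)) = PowerSeries.X - PowerSeries.C u := by
  ext n
  have hd : deriv (fun z : ℂ => z - u) = fun _ => 1 := by
    funext z
    simp
  rcases n with _ | _ | n
  · simp [taylorCoeff]
  · simp [taylorCoeff]
  · simp [taylorCoeff, iteratedDeriv_succ', hd, PowerSeries.coeff_X]

lemma phiW_pos {w : ℕ → ℝ} (hw : ∀ n, 0 < w n) (n : ℕ) : 0 < phiW w n :=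
  Finset.sum_pos (fun j _ => one_div_pos.2 (hw j)) ⟨0, by simp⟩

lemma phiW_succ (w : ℕ → ℝ) (n : ℕ) : phiW w (n + 1) = phiW w n + 1 / w (n + 1) :=
  Finset.sum_range_succ _ _

/-- The polynomial `(1 - r) / (z - u)`, where `r` has minimal norm among polynomials of degree at
most `n` with `r u = 1`. -/
noncomputable def linearApproximant (w : ℕ → ℝ) (u : ℂ) (n k : ℕ) : ℂ :=
  -(u⁻¹) ^ (k + 1) * ((1 - phiW w (min k n) / phiW w n : ℝ) : ℂ)

lemma isPolySeq_linearApproximant {w : ℕ → ℝ} (hw : ∀ n, 0 < w n) (u : ℂ) (n : ℕ) :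
    IsPolySeq (linearApproximant w u n) := by
  refine ⟨n, fun k hk => ?_⟩
  rw [linearApproximant, min_eq_right hk.le, div_self (phiW_pos hw n).ne']
  simp

lemma cProd_linearApproximant_sub_onePS {w : ℕ → ℝ} {u : ℂ} (hu : u ≠ 0)
    (n k : ℕ) : (cProd (linearApproximant w u n) (taylorCoeff (· - u)) - onePS) k =
      if k ≤ n then -(u⁻¹) ^ k * ((1 / w k / phiW w n : ℝ) : ℂ) else 0 := by
  rw [Pi.sub_apply, cProd_eq_coeff, mk_taylorCoeff_sub_const, mul_sub, map_sub]
  rcases k with _ | k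
  · simp [linearApproximant, onePS, phiW]
    field_simp
    ring
  · rw [PowerSeries.coeff_succ_mul_X, PowerSeries.coeff_mul_C, PowerSeries.coeff_mk,
      PowerSeries.coeff_mk]
    simp only [linearApproximant, onePS, Nat.add_eq_zero_iff, one_ne_zero, and_false, if_false,
      sub_zero]
    split_ifs with h
    · rw [min_eq_left (by omega : k ≤ n), min_eq_left h, phiW_succ, pow_succ (u⁻¹) (k + 1)]
      push_cast
      field_simp
      ring
    · rw [min_eq_right (by omega : n ≤ k), min_eq_right (by omega : n ≤ k + 1),
        pow_succ (u⁻¹) (k + 1)]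
      field_simp
      ring

lemma normSqHw_linearApproximant {w : ℕ → ℝ} (hw : ∀ n, 0 < w n) {u : ℂ} (hu : ‖u‖ = 1) (n : ℕ) :
    normSqHw w (cProd (linearApproximant w u n) (taylorCoeff (· - u)) - onePS) =
      1 / phiW w n := by
  have hu0 : u ≠ 0 := norm_ne_zero_iff.1 (by rw [hu]; exact one_ne_zero)
  have hφ := phiW_pos hw n
  rw [normSqHw, tsum_eq_sum (s := Finset.range (n + 1))]
  · have hterm : ∀ k ∈ Finset.range (n + 1),
        w k * ‖(cProd (linearApproximant w u n) (taylorCoeff (· - u)) - onePS) k‖ ^ 2 =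
          1 / w k * (1 / phiW w n ^ 2) := by
      intro k hk
      have hwk := hw k
      rw [cProd_linearApproximant_sub_onePS hu0,
        if_pos (Nat.lt_succ_iff.1 (Finset.mem_range.1 hk)), norm_mul, norm_neg, norm_pow, norm_inv,
        hu, inv_one, one_pow, one_mul, Complex.norm_real, Real.norm_eq_abs, sq_abs]
      field_simp
    rw [Finset.sum_congr rfl hterm, ← Finset.sum_mul]
    change phiW w n * _ = _
    field_simp
  · intro k hk
    rw [cProd_linearApproximant_sub_onePS hu0,
      if_neg fun h => hk (Finset.mem_range.2 (Nat.lt_succ_iff.2 h))]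
    simp

lemma cyclicHw_sub_const {w : ℕ → ℝ} (hw : ∀ n, 0 < w n) (hsum : ¬ Summable fun k => 1 / w k)
    {u : ℂ} (hu : ‖u‖ = 1) : CyclicHw w (taylorCoeff (· - u)) := by
  rw [cyclicHw_iff_normSqHw]
  intro ε hε
  have ht := (not_summable_iff_tendsto_nat_atTop_of_nonneg
    fun k => (one_div_pos.2 (hw k)).le).1 hsum
  obtain ⟨n, hn⟩ := (((tendsto_add_atTop_iff_nat 1).2 ht).eventually_gt_atTop (1 / ε)).exists
  refine ⟨_, isPolySeq_linearApproximant hw u n, ?_⟩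
  rw [normSqHw_linearApproximant hw hu]
  exact (one_div_lt hε (phiW_pos hw n)).1 hn

/-- If `∑ 1 / w k` converges, evaluation at a point of the unit circle is bounded, so a function
vanishing there is not cyclic. -/
lemma not_summable_of_cyclicHw {w : ℕ → ℝ} (hw : ∀ n, 0 < w n)
    (hw1 : Tendsto (fun n => w (n + 1) / w n) atTop (nhds 1)) {R : ℝ} (hR : 1 < R) {F : ℂ → ℂ}
    (hF : ∀ z ∈ Metric.ball (0 : ℂ) R, AnalyticAt ℂ F z) {u : ℂ} (hu : ‖u‖ = 1) (hFu : F u = 0)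
    (hcyc : CyclicHw w (taylorCoeff F)) : ¬ Summable fun k => 1 / w k := by
  intro hs
  set S := ∑' k, 1 / w k with hS
  have hSpos : 0 < S := hs.tsum_pos (fun k => (one_div_pos.2 (hw k)).le) 0 (one_div_pos.2 (hw 0))
  obtain ⟨p, hp, hlt⟩ := (cyclicHw_iff_normSqHw _).1 hcyc (1 / S) (by positivity)
  set q := cProd p (taylorCoeff F) - onePS with hq
  have hFd := geomDecay_taylorCoeff hR hF
  obtain ⟨M, -, hbound⟩ := hp.geomDecay.exists_multiplier_bound hw hw1
  have hqmem : MemHw w q := (hbound _ (hFd.memHw hw hw1)).1.sub hw (memHw_onePS w)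
  have hFsum := hasSum_taylorCoeff hF (z := u) (by rwa [hu])
  have hpn : Summable fun n => ‖p n * u ^ n‖ := by
    simpa [hu] using hp.geomDecay.summable_norm
  have hprod : HasSum (fun n => cProd p (taylorCoeff F) n * u ^ n) 0 := by
    have h := hasSum_sum_range_mul_of_summable_norm hpn hFsum.summable.norm
    rw [hFsum.tsum_eq, hFu, mul_zero] at h
    refine h.congr_fun fun n => ?_
    rw [cProd, Finset.sum_mul]
    refine Finset.sum_congr rfl fun k hk => ?_
    rw [← Nat.add_sub_of_le (Nat.lt_succ_iff.1 (Finset.mem_range.1 hk))]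
    simp only [Nat.add_sub_cancel_left, pow_add]
    ring
  have hone : HasSum (fun n => onePS n * u ^ n) 1 := by
    convert hasSum_ite_eq (0 : ℕ) (1 : ℂ) using 2 with n
    by_cases hn : n = 0 <;> simp [onePS, hn]
  have hqsum : HasSum (fun n => q n * u ^ n) (-1) := by
    simpa [hq, sub_mul] using hprod.sub hone
  have hterm : ∀ n, ‖q n * u ^ n‖ ≤ S / 2 * (w n * ‖q n‖ ^ 2) + 1 / (2 * S) * (1 / w n) := by
    intro n
    have hwn := hw n
    rw [norm_mul, norm_pow, hu, one_pow, mul_one]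
    have h : S / 2 * (w n * ‖q n‖ ^ 2) + 1 / (2 * S) * (1 / w n) - ‖q n‖ =
        (S * w n * ‖q n‖ - 1) ^ 2 / (2 * S * w n) := by
      field_simp
      ring
    have h2 : 0 ≤ (S * w n * ‖q n‖ - 1) ^ 2 / (2 * S * w n) := by positivity
    linarith
  have hmaj := (hqmem.mul_left (S / 2)).add (hs.mul_left (1 / (2 * S)))
  have h1 : ‖∑' n, q n * u ^ n‖ ≤ _ := tsum_of_norm_bounded hmaj.hasSum hterm
  rw [hqsum.tsum_eq, (hqmem.mul_left (S / 2)).tsum_add (hs.mul_left (1 / (2 * S))), tsum_mul_left,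
    tsum_mul_left, norm_neg, norm_one, ← hS] at h1
  change 1 ≤ S / 2 * normSqHw w q + 1 / (2 * S) * S at h1
  have h2 : 1 / (2 * S) * S = 1 / 2 := by field_simp
  rw [lt_div_iff₀ hSpos] at hlt
  nlinarith

/-- `F` is analytic on a disc of radius larger than one and its Taylor coefficients are cyclic. -/
def AnalyticCyclic (w : ℕ → ℝ) (F : ℂ → ℂ) : Prop :=
  (∃ R : ℝ, 1 < R ∧ ∀ z ∈ Metric.ball (0 : ℂ) R, AnalyticAt ℂ F z) ∧ CyclicHw w (taylorCoeff F)

lemma AnalyticCyclic.mul {w : ℕ → ℝ} (hw : ∀ n, 0 < w n)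
    (hw1 : Tendsto (fun n => w (n + 1) / w n) atTop (nhds 1)) {F G : ℂ → ℂ}
    (hF : AnalyticCyclic w F) (hG : AnalyticCyclic w G) : AnalyticCyclic w (F * G) := by
  obtain ⟨⟨R, hR, hFa⟩, hFc⟩ := hF
  obtain ⟨⟨R', hR', hGa⟩, hGc⟩ := hG
  refine ⟨⟨min R R', lt_min hR hR', fun z hz => ?_⟩, ?_⟩
  · exact (hFa z (Metric.ball_subset_ball (min_le_left _ _) hz)).mul
      (hGa z (Metric.ball_subset_ball (min_le_right _ _) hz))
  · rw [taylorCoeff_mul (hFa 0 (by simp; linarith)) (hGa 0 (by simp; linarith))]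
    exact CyclicHw.cProd hw hw1 (geomDecay_taylorCoeff hR hFa) (geomDecay_taylorCoeff hR' hGa)
      hFc hGc

lemma analyticCyclic_of_ne_zero {w : ℕ → ℝ} (hw : ∀ n, 0 < w n)
    (hw1 : Tendsto (fun n => w (n + 1) / w n) atTop (nhds 1)) {G : ℂ → ℂ}
    (hG : AnalyticOnNhd ℂ G (Metric.closedBall 0 1)) (hG0 : ∀ z ∈ Metric.closedBall 0 1, G z ≠ 0) :
    AnalyticCyclic w G := by
  have hopen : IsOpen {z | AnalyticAt ℂ G z ∧ G z ≠ 0} := by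
    rw [isOpen_iff_mem_nhds]
    rintro z ⟨hz, hz0⟩
    exact hz.eventually_analyticAt.and (hz.continuousAt.eventually_ne hz0)
  obtain ⟨δ, hδ, hsub⟩ := (isCompact_closedBall (0 : ℂ) 1).exists_thickening_subset_open hopen
    fun z hz => ⟨hG z hz, hG0 z hz⟩
  rw [thickening_closedBall hδ zero_le_one] at hsub
  have hR : 1 < δ + 1 := by linarith
  have hGa : ∀ z ∈ Metric.ball (0 : ℂ) (δ + 1), AnalyticAt ℂ G z := fun z hz => (hsub hz).1
  have hIa : ∀ z ∈ Metric.ball (0 : ℂ) (δ + 1), AnalyticAt ℂ G⁻¹ z :=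
    fun z hz => (hsub hz).1.inv (hsub hz).2
  have h0 : (0 : ℂ) ∈ Metric.ball (0 : ℂ) (δ + 1) := by simp; linarith
  refine ⟨⟨δ + 1, hR, hGa⟩, cyclicHw_of_cProd_eq_onePS hw hw1 (geomDecay_taylorCoeff hR hIa)
    (geomDecay_taylorCoeff hR hGa) ?_⟩
  rw [← taylorCoeff_mul (hIa 0 h0) (hGa 0 h0), ← taylorCoeff_one]
  refine taylorCoeff_congr ?_
  filter_upwards [Metric.isOpen_ball.mem_nhds h0] with z hz
  simp [(hsub hz).2]

lemma analyticCyclic_one {w : ℕ → ℝ} (hw : ∀ n, 0 < w n)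
    (hw1 : Tendsto (fun n => w (n + 1) / w n) atTop (nhds 1)) : AnalyticCyclic w 1 :=
  analyticCyclic_of_ne_zero hw hw1 (fun _ _ => analyticAt_const) fun _ _ => one_ne_zero

lemma analyticCyclic_sub_const {w : ℕ → ℝ} (hw : ∀ n, 0 < w n)
    (hsum : ¬ Summable fun k => 1 / w k) {u : ℂ} (hu : ‖u‖ = 1) : AnalyticCyclic w (· - u) :=
  ⟨⟨2, one_lt_two, fun _ _ => by fun_prop⟩, cyclicHw_sub_const hw hsum hu⟩

lemma AnalyticCyclic.pow {w : ℕ → ℝ} (hw : ∀ n, 0 < w n)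
    (hw1 : Tendsto (fun n => w (n + 1) / w n) atTop (nhds 1)) {F : ℂ → ℂ}
    (hF : AnalyticCyclic w F) (n : ℕ) : AnalyticCyclic w (F ^ n) := by
  induction n with
  | zero => simpa using analyticCyclic_one hw hw1
  | succ n ih =>
    rw [pow_succ]
    exact ih.mul hw hw1 hF

lemma cyclicHw_of_not_summable {w : ℕ → ℝ} (hw : ∀ n, 0 < w n)
    (hw1 : Tendsto (fun n => w (n + 1) / w n) atTop (nhds 1))
    (hsum : ¬ Summable fun k => 1 / w k) {R : ℝ} (hR : 1 < R) {F : ℂ → ℂ}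
    (hF : ∀ z ∈ Metric.ball (0 : ℂ) R, AnalyticAt ℂ F z) (hF0 : ∀ z : ℂ, ‖z‖ < 1 → F z ≠ 0) :
    CyclicHw w (taylorCoeff F) := by
  set U := Metric.closedBall (0 : ℂ) 1 with hU
  have hFU : AnalyticOnNhd ℂ F U := fun z hz => hF z (Metric.closedBall_subset_ball hR hz)
  have hconn : IsPreconnected U := (convex_closedBall (0 : ℂ) 1).isPreconnected
  have h0U : (0 : ℂ) ∈ U := by simp [hU]
  have horder : ∀ z ∈ U, F z ≠ 0 → meromorphicOrderAt F z = 0 := fun z hz h => by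
    rw [(hFU z hz).meromorphicOrderAt_eq, (hFU z hz).analyticOrderAt_eq_zero.2 h]
    rfl
  have htop : ∀ u : U, meromorphicOrderAt F u ≠ ⊤ := fun u =>
    hFU.meromorphicOn.meromorphicOrderAt_ne_top_of_isPreconnected hconn h0U u.2 (by
      rw [horder 0 h0U (hF0 0 (by simp))]
      exact WithTop.zero_ne_top)
  obtain ⟨G, hG, hG0, hfac⟩ := hFU.meromorphicOn.extract_zeros_poles htop
    ((MeromorphicOn.divisor F U).finiteSupport (isCompact_closedBall 0 1))
  set P : ℂ → ℂ := ∏ᶠ u, (· - u) ^ MeromorphicOn.divisor F U u with hP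
  have hPc : AnalyticCyclic w P := by
    refine finprod_induction (AnalyticCyclic w) (analyticCyclic_one hw hw1)
      (fun _ _ h1 h2 => h1.mul hw hw1 h2) fun u => ?_
    by_cases hu : ‖u‖ = 1
    · obtain ⟨n, hn⟩ := Int.eq_ofNat_of_zero_le (MeromorphicOn.AnalyticOnNhd.divisor_nonneg hFU u)
      rw [hn]
      simpa using (analyticCyclic_sub_const hw hsum hu).pow hw hw1 n
    · have hD : MeromorphicOn.divisor F U u = 0 := by
        by_cases huU : u ∈ U
        · rw [MeromorphicOn.divisor_apply hFU.meromorphicOn huU,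
            horder u huU (hF0 u (lt_of_le_of_ne (by simpa [hU] using huU) hu))]
          rfl
        · exact Function.locallyFinsuppWithin.apply_eq_zero_of_notMem _ huU
      rw [hD]
      simpa using analyticCyclic_one hw hw1
  have hGc : AnalyticCyclic w G :=
    analyticCyclic_of_ne_zero hw hw1 hG fun z hz => hG0 ⟨z, hz⟩
  have hPG := hPc.mul hw hw1 hGc
  have hPGa : AnalyticAt ℂ (P * G) 0 := by
    obtain ⟨⟨r, hr, h⟩, -⟩ := hPG
    exact h 0 (by simp; linarith)
  have hev : F =ᶠ[nhds 0] P * G := by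
    refine ((hFU 0 h0U).frequently_eq_iff_eventually_eq hPGa).1 ?_
    refine Eventually.frequently ?_
    have h1 := mem_codiscreteWithin_iff_forall_mem_nhdsNE.1 hfac 0 h0U
    have h2 : U ∈ nhdsWithin (0 : ℂ) {0}ᶜ :=
      mem_nhdsWithin_of_mem_nhds (Metric.closedBall_mem_nhds 0 one_pos)
    filter_upwards [h1, h2] with z hz hzU
    simpa [hzU] using hz
  rw [taylorCoeff_congr hev]
  exact hPG.2

theorem cyclicity_characterization
    (w : ℕ → ℝ) (hw : ∀ n, 0 < w n)
    (hw1 : Filter.Tendsto (fun n => w (n + 1) / w n) Filter.atTop (nhds 1)) :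
    ((∀ (R : ℝ), 1 < R → ∀ F : ℂ → ℂ,
        (∀ z ∈ Metric.ball (0 : ℂ) R, AnalyticAt ℂ F z) →
        (∀ z : ℂ, ‖z‖ < 1 → F z ≠ 0) →
        CyclicHw w (taylorCoeff F))
      ↔ ¬ Summable fun k => 1 / w k) ∧
    ((∃ (R : ℝ) (F : ℂ → ℂ), 1 < R ∧
        (∀ z ∈ Metric.ball (0 : ℂ) R, AnalyticAt ℂ F z) ∧
        (∀ z : ℂ, ‖z‖ < 1 → F z ≠ 0) ∧
        (∃ θ : ℝ, F (Complex.exp (θ * Complex.I)) = 0) ∧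
        CyclicHw w (taylorCoeff F))
      ↔ ¬ Summable fun k => 1 / w k) := by
  have hone : ∀ z : ℂ, ‖z‖ < 1 → z - 1 ≠ 0 := fun z hz h => by
    rw [sub_eq_zero.1 h, norm_one] at hz
    exact lt_irrefl _ hz
  refine ⟨⟨fun h => ?_, fun hsum R hR F hF hF0 =>
      cyclicHw_of_not_summable hw hw1 hsum hR hF hF0⟩,
    fun ⟨R, F, hR, hF, _, ⟨θ, hθ⟩, hcyc⟩ =>
      not_summable_of_cyclicHw hw hw1 hR hF (Complex.norm_exp_ofReal_mul_I θ) hθ hcyc,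
    fun hsum => ?_⟩
  · exact not_summable_of_cyclicHw hw hw1 one_lt_two (F := (· - 1)) (fun _ _ => by fun_prop)
      (u := 1) norm_one (sub_self 1) (h 2 one_lt_two _ (fun _ _ => by fun_prop) hone)
  · exact ⟨2, (· - 1), one_lt_two, fun _ _ => by fun_prop, hone, ⟨0, by simp⟩,
      cyclicHw_sub_const hw hsum norm_one⟩
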